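/- arXiv:1707.01816 — 4 statements merged into one kernel-verified Lean document; each statement's English description precedes it below -/
import Mathlib

section
/- Let G be a symmetric game in normal form with a finite nonempty set of players P, a common finite nonempty strategy set Υ, and payoffs u_i taking values in a linear order. If the constant strategy profile (σ, σ, ..., σ) is a Hofstadter equilibrium of G, then for every player i the strategy σ is not minimax-dominated in G: for every strategy υ ∈ Υ, the maximum over opponent strategy combinations τ_{-i} of u_i(σ, τ_{-i}) is greater than or equal to the minimum over opponent strategy combinations τ_{-i} of u_i(υ, τ_{-i}). -/
/-- A game in normal form (with player set `P`, common strategy set `Υ` and payoffs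
`u` valued in a linear order `R`) is symmetric if it is invariant under every
permutation of the players. -/
def IsSymmetricGame {P Υ R : Type*} [LinearOrder R]
    (u : P → (P → Υ) → R) : Prop :=
  ∀ (π : Equiv.Perm P) (τ : P → Υ) (i : P), u i τ = u (π i) (τ ∘ π)

/-- The constant (diagonal) strategy profile `(σ, σ, ..., σ)` is a Hofstadter
equilibrium if it maximizes every player's payoff among all constant profiles. -/
def IsHofstadterEq {P Υ R : Type*} [LinearOrder R]
    (u : P → (P → Υ) → R) (σ : Υ) : Prop :=
  ∀ (υ : Υ) (i : P), u i (fun _ => υ) ≤ u i (fun _ => σ)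

/-- In a symmetric game, the strategy `σ` of a Hofstadter equilibrium
`(σ, σ, ..., σ)` is not minimax-dominated: for every player `i` and every
alternative strategy `υ`, the maximum over opponent strategy combinations of
player `i`'s payoff when playing `σ` is at least the minimum over opponent
strategy combinations of player `i`'s payoff when playing `υ`. -/
theorem hofstadterEq_not_minimax_dominated
    {P Υ R : Type*} [Fintype P] [Nonempty P] [DecidableEq P]
    [Fintype Υ] [Nonempty Υ] [LinearOrder R]
    (u : P → (P → Υ) → R)
    (hsym : IsSymmetricGame u)
    (σ : Υ) (hHof : IsHofstadterEq u σ) :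
    ∀ (i : P) (υ : Υ),
      Finset.univ.sup' Finset.univ_nonempty
          (fun τ : P → Υ => u i (Function.update τ i σ)) ≥
        Finset.univ.inf' Finset.univ_nonempty
          (fun τ : P → Υ => u i (Function.update τ i υ)) := by
  intro i υ
  calc
    _ ≤ u i (Function.update (fun _ => υ) i υ) :=
      Finset.inf'_le (fun τ : P → Υ => u i (Function.update τ i υ)) (Finset.mem_univ _)
    _ = u i (fun _ => υ) := congrArg (u i) (Function.update_eq_self i fun _ => υ)
    _ ≤ u i (fun _ => σ) := hHof υ i
    _ = u i (Function.update (fun _ => σ) i σ) :=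
      congrArg (u i) (Function.update_eq_self i fun _ => σ).symm
    _ ≤ _ :=
      Finset.le_sup' (fun τ : P → Υ => u i (Function.update τ i σ)) (Finset.mem_univ _)
end

section
/- Let G be a symmetric game in normal form with a finite nonempty set of players P, a common finite nonempty strategy set Υ, and payoffs u_i taking values in a linear order. Define the iterated minimax elimination sequence of strategy sets by T⁰ = Υ for every player and T^{n+1} consisting of those strategies in T^n that are not minimax-dominated relative to T^n (symmetry guarantees the surviving set is the same for all players, so elimination can be performed simultaneously for all players). If (σ, σ, ..., σ) is a Hofstadter equilibrium of G, then σ ∈ T^n for every n; that is, every Hofstadter equilibrium is minimax-rationalizable. -/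
/-- The strategy profiles valued in the allowed subset `T` of strategies. -/
def TProfiles {P Υ : Type*} [Fintype P] [DecidableEq P] [Fintype Υ] [DecidableEq Υ]
    (T : Finset Υ) : Finset (P → Υ) :=
  Finset.univ.filter fun τ => ∀ j, τ j ∈ T

theorem tProfiles_nonempty {P Υ : Type*} [Fintype P] [DecidableEq P] [Fintype Υ] [DecidableEq Υ]
    {T : Finset Υ} {υ : Υ} (h : υ ∈ T) : (TProfiles (P := P) T).Nonempty :=
  ⟨fun _ => υ, by simp [TProfiles, h]⟩

/-- A strategy `σ` of player `i` is minimax-dominated relative to the common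
allowed strategy subset `T` if there is a strategy `υ ∈ T` whose minimum payoff
over all `T`-valued opponent strategy combinations exceeds the maximum payoff of
`σ` over all `T`-valued opponent strategy combinations. -/
def MinimaxDominated {P Υ R : Type*} [Fintype P] [DecidableEq P]
    [Fintype Υ] [DecidableEq Υ] [LinearOrder R]
    (u : P → (P → Υ) → R) (T : Finset Υ) (i : P) (σ : Υ) : Prop :=
  ∃ (υ : Υ) (h : υ ∈ T),
    (TProfiles T).sup' (tProfiles_nonempty h)
        (fun τ => u i (Function.update τ i σ)) <
      (TProfiles T).inf' (tProfiles_nonempty h)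
        (fun τ => u i (Function.update τ i υ))

/-- The iterated minimax elimination sequence: `T⁰ = Υ`, and `T^{n+1}` consists of
the strategies of `T^n` that are not minimax-dominated (for any player) relative
to `T^n`.  By symmetry the surviving set is the same for all players, so
elimination is performed simultaneously for all players. -/
noncomputable def elimSeq {P Υ R : Type*} [Fintype P] [DecidableEq P]
    [Fintype Υ] [DecidableEq Υ] [LinearOrder R]
    (u : P → (P → Υ) → R) : ℕ → Finset Υ
  | 0 => Finset.univ
  | n + 1 =>
      @Finset.filter _ (fun σ => ∀ i : P, ¬ MinimaxDominated u (elimSeq u n) i σ)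
        (Classical.decPred _) (elimSeq u n)

/-- A Hofstadter equilibrium is not minimax-dominated relative to any strategy set
containing it. -/
theorem IsHofstadterEq.not_minimaxDominated {P Υ R : Type*} [Fintype P] [DecidableEq P]
    [Fintype Υ] [DecidableEq Υ] [LinearOrder R] {u : P → (P → Υ) → R} {σ : Υ}
    (hHof : IsHofstadterEq u σ) {T : Finset Υ} (hσ : σ ∈ T) (i : P) :
    ¬ MinimaxDominated u T i σ := by
  rintro ⟨υ, hυ, hlt⟩
  have mem_const {ρ : Υ} (hρ : ρ ∈ T) : (fun _ => ρ) ∈ TProfiles (P := P) T := by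
    simp [TProfiles, hρ]
  have hmin := Finset.inf'_le (fun τ => u i (Function.update τ i υ)) (mem_const hυ)
  have hmax := Finset.le_sup' (fun τ => u i (Function.update τ i σ)) (mem_const hσ)
  have update_const (ρ : Υ) : Function.update (fun _ : P => ρ) i ρ = fun _ => ρ :=
    Function.update_eq_self i (fun _ : P => ρ)
  rw [update_const] at hmin hmax
  exact ((hmax.trans_lt hlt).trans_le hmin).not_ge (hHof υ i)

/-- In a symmetric game, a Hofstadter equilibrium survives every round of
iterated deletion of minimax-dominated strategies: it is minimax-rationalizable. -/
theorem hofstadterEq_minimax_rationalizable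
    {P Υ R : Type*} [Fintype P] [Nonempty P] [DecidableEq P]
    [Fintype Υ] [Nonempty Υ] [DecidableEq Υ] [LinearOrder R]
    (u : P → (P → Υ) → R)
    (hsym : IsSymmetricGame u)
    (σ : Υ) (hHof : IsHofstadterEq u σ) :
    ∀ n : ℕ, σ ∈ elimSeq u n := by
  intro n
  induction n with
  | zero => simp [elimSeq]
  | succ n ih =>
    exact (@Finset.mem_filter _ _ (Classical.decPred _) _ _).2 ⟨ih, fun i => hHof.not_minimaxDominated ih i⟩
end

section
/- Let G be a symmetric game in normal form with a finite nonempty set of players P, a common finite nonempty strategy set Υ, and payoffs u_i taking values in a linear order. If the constant strategy profile (σ, σ, ..., σ) is a Hofstadter equilibrium of G, then it is individually rational: for every player i, u_i(σ, σ, ..., σ) ≥ max over τ_i ∈ Υ of min over opponent strategy combinations τ_{-i} of u_i(τ_i, τ_{-i}). -/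
/-- In a symmetric game, a Hofstadter equilibrium `(σ, σ, ..., σ)` is individually
rational: every player `i` receives at least the maximum over his strategies
`τᵢ` of the minimum over opponent strategy combinations `τ₋ᵢ` of `uᵢ(τᵢ, τ₋ᵢ)`. -/
theorem hofstadterEq_individually_rational
    {P Υ R : Type*} [Fintype P] [Nonempty P] [DecidableEq P]
    [Fintype Υ] [Nonempty Υ] [LinearOrder R]
    (u : P → (P → Υ) → R)
    (hsym : IsSymmetricGame u)
    (σ : Υ) (hHof : IsHofstadterEq u σ) :
    ∀ i : P,
      u i (fun _ => σ) ≥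
        Finset.univ.sup' Finset.univ_nonempty (fun τi : Υ =>
          Finset.univ.inf' Finset.univ_nonempty
            (fun τ : P → Υ => u i (Function.update τ i τi))) := by
  intro i
  refine Finset.sup'_le _ _ fun τi _ => ?_
  calc _ ≤ u i (Function.update (fun _ => τi) i τi) :=
        Finset.inf'_le (fun τ : P → Υ => u i (Function.update τ i τi)) (Finset.mem_univ _)
    _ = u i (fun _ => τi) := by rw [Function.update_eq_self i (fun _ => τi)]
    _ ≤ _ := hHof τi i
end

section
/- There exists a finite symmetric two-player game in normal form (with real-valued payoffs) and a strategy profile that is individually rational but does not survive two rounds of iterated deletion of minimax-dominated strategies; that is, individual rationality of a strategy profile does not imply minimax-rationalizability. -/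
/-- Player 1's strategy `σ` is minimax-dominated relative to the allowed strategy
sets `(T1, T2)`: some `υ ∈ T1` has minimum payoff over `T2` strictly above the
maximum payoff of `σ` over `T2`. -/
def Dominated1 {Υ : Type*} [DecidableEq Υ]
    (u1 : Υ → Υ → ℝ) (T1 T2 : Finset Υ) (σ : Υ) : Prop :=
  ∃ (υ : Υ) (_ : υ ∈ T1) (hT2 : T2.Nonempty),
    T2.sup' hT2 (fun b => u1 σ b) < T2.inf' hT2 (fun b => u1 υ b)

/-- Player 2's strategy `σ` is minimax-dominated relative to the allowed strategy
sets `(T1, T2)`: some `υ ∈ T2` has minimum payoff over `T1` strictly above the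
maximum payoff of `σ` over `T1`. -/
def Dominated2 {Υ : Type*} [DecidableEq Υ]
    (u2 : Υ → Υ → ℝ) (T1 T2 : Finset Υ) (σ : Υ) : Prop :=
  ∃ (υ : Υ) (_ : υ ∈ T2) (hT1 : T1.Nonempty),
    T1.sup' hT1 (fun a => u2 a σ) < T1.inf' hT1 (fun a => u2 a υ)

/-- Iterated simultaneous deletion of minimax-dominated strategies, starting from
the full strategy sets: `elim2 u1 u2 n` is the pair of sets of strategies of the
two players surviving `n` rounds. -/
noncomputable def elim2 {Υ : Type*} [Fintype Υ] [DecidableEq Υ]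
    (u1 u2 : Υ → Υ → ℝ) : ℕ → Finset Υ × Finset Υ
  | 0 => (Finset.univ, Finset.univ)
  | n + 1 =>
      (@Finset.filter _ (fun σ => ¬ Dominated1 u1 (elim2 u1 u2 n).1 (elim2 u1 u2 n).2 σ)
          (Classical.decPred _) (elim2 u1 u2 n).1,
        @Finset.filter _ (fun σ => ¬ Dominated2 u2 (elim2 u1 u2 n).1 (elim2 u1 u2 n).2 σ)
          (Classical.decPred _) (elim2 u1 u2 n).2)

/-- The profile `(σ1, σ2)` is individually rational: each player gets at least his
maximin value. -/
def IndRational {Υ : Type*} [Fintype Υ] [Nonempty Υ]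
    (u1 u2 : Υ → Υ → ℝ) (σ1 σ2 : Υ) : Prop :=
  u1 σ1 σ2 ≥
      Finset.univ.sup' Finset.univ_nonempty (fun a : Υ =>
        Finset.univ.inf' Finset.univ_nonempty (fun b : Υ => u1 a b)) ∧
    u2 σ1 σ2 ≥
      Finset.univ.sup' Finset.univ_nonempty (fun b : Υ =>
        Finset.univ.inf' Finset.univ_nonempty (fun a : Υ => u2 a b))

/-- The profile `(σ1, σ2)` is a Hofstadter equilibrium: it is a diagonal profile
maximizing both players' payoffs among diagonal profiles. -/
def Hofstadter2 {Υ : Type*} (u1 u2 : Υ → Υ → ℝ) (σ1 σ2 : Υ) : Prop :=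
  σ1 = σ2 ∧ ∀ υ : Υ, u1 υ υ ≤ u1 σ1 σ1 ∧ u2 υ υ ≤ u2 σ1 σ1

theorem mem_elim2_succ_fst {Υ : Type*} [Fintype Υ] [DecidableEq Υ] {u1 u2 : Υ → Υ → ℝ}
    {n : ℕ} {σ : Υ} : σ ∈ (elim2 u1 u2 (n + 1)).1 ↔
      σ ∈ (elim2 u1 u2 n).1 ∧ ¬ Dominated1 u1 (elim2 u1 u2 n).1 (elim2 u1 u2 n).2 σ :=
  @Finset.mem_filter _ _ (Classical.decPred _) _ _

theorem mem_elim2_succ_snd {Υ : Type*} [Fintype Υ] [DecidableEq Υ] {u1 u2 : Υ → Υ → ℝ}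
    {n : ℕ} {σ : Υ} : σ ∈ (elim2 u1 u2 (n + 1)).2 ↔
      σ ∈ (elim2 u1 u2 n).2 ∧ ¬ Dominated2 u2 (elim2 u1 u2 n).1 (elim2 u1 u2 n).2 σ :=
  @Finset.mem_filter _ _ (Classical.decPred _) _ _

/-- Row player's payoff in a three-strategy game where `2` is minimax-dominated by `0`, and
once `2` is deleted, `0` is minimax-dominated by `1`. -/
def cautiousPayoff (a b : Fin 3) : ℝ :=
  if a = 0 then 1 else if a = 1 ∧ b ≠ 2 then 2 else 0

theorem sup'_inf'_cautiousPayoff_le_one :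
    Finset.univ.sup' Finset.univ_nonempty (fun a : Fin 3 =>
      Finset.univ.inf' Finset.univ_nonempty (fun b : Fin 3 => cautiousPayoff a b)) ≤ 1 := by
  refine Finset.sup'_le _ _ fun a _ => ?_
  refine (Finset.inf'_le _ (Finset.mem_univ 2)).trans ?_
  fin_cases a <;> simp [cautiousPayoff]

theorem dominated2_cautiousPayoff_two :
    Dominated2 (fun a b => cautiousPayoff b a) Finset.univ Finset.univ 2 := by
  refine ⟨0, Finset.mem_univ _, Finset.univ_nonempty, ?_⟩
  simp [cautiousPayoff]

theorem not_dominated1_cautiousPayoff_one :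
    ¬ Dominated1 cautiousPayoff Finset.univ Finset.univ 1 := by
  rintro ⟨a, -, h, hlt⟩
  have h1 := Finset.le_sup' (fun b => cautiousPayoff 1 b) (Finset.mem_univ (0 : Fin 3))
  have h2 := Finset.inf'_le (fun b => cautiousPayoff a b) (Finset.mem_univ (0 : Fin 3))
  have h3 : cautiousPayoff a 0 ≤ cautiousPayoff 1 0 := by
    have h02 : (0 : Fin 3) ≠ 2 := by decide
    fin_cases a <;> norm_num [cautiousPayoff, h02]
  linarith

theorem not_dominated2_cautiousPayoff_zero :
    ¬ Dominated2 (fun a b => cautiousPayoff b a) Finset.univ Finset.univ 0 := by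
  rintro ⟨a, -, h, hlt⟩
  have h1 := Finset.le_sup' (fun b => cautiousPayoff 0 b) (Finset.mem_univ (2 : Fin 3))
  have h2 := Finset.inf'_le (fun b => cautiousPayoff a b) (Finset.mem_univ (2 : Fin 3))
  have h3 : cautiousPayoff a 2 ≤ cautiousPayoff 0 2 := by
    fin_cases a <;> norm_num [cautiousPayoff]
  linarith

theorem dominated1_cautiousPayoff_zero {T1 T2 : Finset (Fin 3)} (h1 : 1 ∈ T1)
    (hT2 : T2.Nonempty) (h2 : 2 ∉ T2) : Dominated1 cautiousPayoff T1 T2 0 := by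
  refine ⟨1, h1, hT2, ?_⟩
  rw [Finset.sup'_lt_iff]
  intro b _
  rw [Finset.lt_inf'_iff]
  intro c hc
  have hc2 : c ≠ 2 := fun h => h2 (h ▸ hc)
  simp [cautiousPayoff, hc2]

/-- There is a finite symmetric two-player game in normal form with real-valued
payoffs and a strategy profile that is individually rational but does not survive
two rounds of iterated deletion of minimax-dominated strategies: individual
rationality does not imply minimax-rationalizability. -/
theorem individuallyRational_not_minimax_rationalizable :
    ∃ (k : ℕ) (u1 u2 : Fin (k + 1) → Fin (k + 1) → ℝ) (σ1 σ2 : Fin (k + 1)),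
      (∀ a b, u1 a b = u2 b a) ∧
        IndRational u1 u2 σ1 σ2 ∧
          ¬ (σ1 ∈ (elim2 u1 u2 2).1 ∧ σ2 ∈ (elim2 u1 u2 2).2) := by
  refine ⟨2, cautiousPayoff, fun a b => cautiousPayoff b a, 0, 0, fun _ _ => rfl,
    ⟨sup'_inf'_cautiousPayoff_le_one, sup'_inf'_cautiousPayoff_le_one⟩, ?_⟩
  rintro ⟨h, -⟩
  exact (mem_elim2_succ_fst.1 h).2 (dominated1_cautiousPayoff_zero
    (mem_elim2_succ_fst.2 ⟨Finset.mem_univ _, not_dominated1_cautiousPayoff_one⟩)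
    ⟨0, mem_elim2_succ_snd.2 ⟨Finset.mem_univ _, not_dominated2_cautiousPayoff_zero⟩⟩
    fun h2 => (mem_elim2_succ_snd.1 h2).2 dominated2_cautiousPayoff_two)
end
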